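/- For positive integers k1,…,kr, one has Z(S(y^{k1} x y^{k2−1} x y^{k3−1} ⋯ x y^{kr−1} x)) = ∑_{j=1}^{r} (−1)^{r−j} ∑_{0<n1≤⋯≤n_{j−1}≤n_j>n_{j+1}>⋯>n_r>0} (k_j/n_j) · 1/(n1^{k1}⋯nr^{kr}), where all the series on the right-hand side converge. -/

import Mathlib

open scoped BigOperators

noncomputable section

/-- `ℌ = ℚ⟨x,y⟩`, the free noncommutative polynomial ring in two indeterminates,
realized as the free `ℚ`-algebra on `Bool` (`false ↦ x`, `true ↦ y`). -/
abbrev H : Type := FreeAlgebra ℚ Bool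

/-- The indeterminate `x`. -/
def Hx : H := FreeAlgebra.ι ℚ false

/-- The indeterminate `y`. -/
def Hy : H := FreeAlgebra.ι ℚ true

/-- The multiple zeta value `ζ(k₁,…,k_r) = ∑_{0<n₁<⋯<n_r} 1/(n₁^{k₁}⋯n_r^{k_r})`. -/
def MZV (r : ℕ) (k : Fin r → ℕ) : ℝ :=
  ∑' n : {n : Fin r → ℕ // (∀ i, 0 < n i) ∧ StrictMono n},
    ∏ i, (1 : ℝ) / (n.1 i : ℝ) ^ (k i)

/-- `Z : yℌx → ℝ` is the `ℚ`-linear map with `Z(y x^{k₁-1} ⋯ y x^{k_r-1}) = ζ(k₁,…,k_r)`.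
We encode it as a `ℚ`-linear map on all of `ℌ` whose values on the basis monomials
`y x^{k₁-1} ⋯ y x^{k_r-1}` (with `k_r ≥ 2`) of `yℌx` are the multiple zeta values;
these values determine `Z` uniquely on the subspace `yℌx`. -/
def IsZetaMap (Z : H →ₗ[ℚ] ℝ) : Prop :=
  ∀ (r : ℕ) (k : Fin (r + 1) → ℕ), (∀ i, 1 ≤ k i) → 2 ≤ k (Fin.last r) →
    Z ((List.ofFn fun i => Hy * Hx ^ (k i - 1)).prod) = MZV (r + 1) k

/-- The family `f(A,B) = (Z(A(x+y)^s B))_{s ≥ 0}`. -/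
def fam (Z : H →ₗ[ℚ] ℝ) (A B : H) : ℕ → ℝ := fun s => Z (A * (Hx + Hy) ^ s * B)

/-- The `ℚ`-bilinear product `◇` on `ℌ`, characterized by its recursive defining
properties (which determine it uniquely). -/
def IsDiamond (d : H →ₗ[ℚ] H →ₗ[ℚ] H) : Prop :=
  (∀ w, d w 1 = w) ∧ (∀ w, d 1 w = w) ∧
  (∀ w1 w2, d (Hx * w1) (Hx * w2) = Hx * d w1 (Hx * w2) - Hx * d (Hy * w1) w2) ∧
  (∀ w1 w2, d (Hx * w1) (Hy * w2) = Hx * d w1 (Hy * w2) + Hy * d (Hx * w1) w2) ∧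
  (∀ w1 w2, d (Hy * w1) (Hx * w2) = Hy * d w1 (Hx * w2) + Hx * d (Hy * w1) w2) ∧
  (∀ w1 w2, d (Hy * w1) (Hy * w2) = Hy * d w1 (Hy * w2) - Hy * d (Hx * w1) w2)

/-- The harmonic product `∗` on `ℌ`, characterized by its recursive defining
properties (which determine it uniquely). -/
def IsHarmonic (st : H →ₗ[ℚ] H →ₗ[ℚ] H) : Prop :=
  (∀ w, st w 1 = w) ∧ (∀ w, st 1 w = w) ∧
  (∀ w1 w2, st (Hx * w1) w2 = Hx * st w1 w2) ∧
  (∀ w1 w2, st w1 (Hx * w2) = Hx * st w1 w2) ∧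
  (∀ w1 w2, st (Hy * w1) (Hy * w2) = Hy * (st w1 (Hy * w2) + st (Hy * w1) w2 + Hx * st w1 w2))

/-- The anti-automorphism `τ` of `ℌ` interchanging `x` and `y`, characterized by
being `ℚ`-linear, anti-multiplicative, unital, and swapping the generators. -/
def IsTau (t : H →ₗ[ℚ] H) : Prop :=
  t 1 = 1 ∧ (∀ a b, t (a * b) = t b * t a) ∧ t Hx = Hy ∧ t Hy = Hx

/-- The automorphism `φ` of `ℌ` with `φ(x) = x + y` and `φ(y) = -y`. -/
def phi : H →ₐ[ℚ] H := FreeAlgebra.lift ℚ (fun b => if b then -Hy else Hx + Hy)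

/-- The automorphism `S₁` of `ℌ` with `S₁(x) = x` and `S₁(y) = x + y`. -/
def S1 : H →ₐ[ℚ] H := FreeAlgebra.lift ℚ (fun b => if b then Hx + Hy else Hx)

/-- The Dirichlet series `∑_{n ≥ 1} a_n / n^s` (with `a n` the coefficient indexed by
`n + 1`) converges to `L` at `s`, i.e. its partial sums tend to `L`. -/
def DSConv (a : ℕ → ℝ) (s : ℕ) (L : ℝ) : Prop :=
  Filter.Tendsto (fun N => ∑ n ∈ Finset.range N, a n / ((n : ℝ) + 1) ^ s)
    Filter.atTop (nhds L)


/-- The index condition `0 < n₁ ≤ n₂ ≤ ⋯ ≤ n_j > n_{j+1} > ⋯ > n_r > 0`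
(0-indexed: weakly increasing up to position `j`, strictly decreasing after). -/
def UpDown (r : ℕ) (j : Fin r) (n : Fin r → ℕ) : Prop :=
  (∀ i, 0 < n i) ∧
  ∀ (i : ℕ) (h : i + 1 < r),
    (i + 1 ≤ j.val → n ⟨i, by omega⟩ ≤ n ⟨i + 1, h⟩) ∧
    (j.val ≤ i → n ⟨i + 1, h⟩ < n ⟨i, by omega⟩)

/-- The summand family of the `j`-th series
`∑_{0<n₁≤⋯≤n_j>n_{j+1}>⋯>n_r>0} (k_j/n_j) · 1/(n₁^{k₁}⋯n_r^{k_r})`. -/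
def kawashimaSummand (r : ℕ) (k : Fin r → ℕ) (j : Fin r)
    (n : {n : Fin r → ℕ // UpDown r j n}) : ℝ :=
  ((k j : ℝ) / (n.1 j : ℝ)) * ∏ i, (1 : ℝ) / (n.1 i : ℝ) ^ (k i)

/-! ### Harmonic bounds -/

def hs (n : ℕ) : ℝ := ∑ i ∈ Finset.range (n + 1), (1 : ℝ) / ((i : ℝ) + 1)

def bd (d n : ℕ) : ℝ := hs n ^ d / ((n : ℝ) + 1)

lemma hs_mono : Monotone hs := by
  refine monotone_nat_of_le_succ fun n => ?_
  unfold hs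
  rw [Finset.sum_range_succ _ (n + 1)]
  have : (0 : ℝ) ≤ 1 / (((n + 1 : ℕ) : ℝ) + 1) := by positivity
  linarith

lemma one_le_hs (n : ℕ) : 1 ≤ hs n := by
  have h := hs_mono (Nat.zero_le n)
  simpa [hs] using h

lemma hs_le_log (n : ℕ) : hs n ≤ 1 + Real.log ((n : ℝ) + 1) := by
  have h := harmonic_le_one_add_log (n + 1)
  unfold hs
  simp only [harmonic] at h
  push_cast at h
  simpa using h

lemma hs_pow_isBigO (d : ℕ) :
    (fun n : ℕ => hs n ^ d) =O[Filter.atTop] fun n : ℕ => ((n : ℝ) + 1) ^ (1 / 2 : ℝ) := by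
  have h1 : (fun x : ℝ => (1 + Real.log x) ^ d) =O[Filter.atTop] fun x : ℝ => x ^ (1 / 2 : ℝ) := by
    have h2 : (fun x : ℝ => (1 + Real.log x)) =O[Filter.atTop] Real.log := by
      refine Asymptotics.IsBigO.add ?_ (Asymptotics.isBigO_refl _ _)
      exact (Real.isLittleO_const_log_atTop).isBigO
    refine (h2.pow d).trans ?_
    have h3 := isLittleO_log_rpow_rpow_atTop (s := 1 / 2) (d : ℝ) (by norm_num)
    simpa using h3.isBigO
  have h4 : Filter.Tendsto (fun n : ℕ => (n : ℝ) + 1) Filter.atTop Filter.atTop :=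
    Filter.tendsto_atTop_add_const_right _ _ tendsto_natCast_atTop_atTop
  refine Asymptotics.IsBigO.trans ?_ (h1.comp_tendsto h4)
  refine Asymptotics.IsBigO.of_bound 1 (Filter.Eventually.of_forall fun n => ?_)
  have h5 := hs_le_log n
  have h6 := one_le_hs n
  simp only [Function.comp, one_mul, norm_pow]
  rw [Real.norm_of_nonneg (by linarith), Real.norm_of_nonneg (by linarith)]
  gcongr

lemma bd_nonneg (d n : ℕ) : 0 ≤ bd d n := by
  have := one_le_hs n
  unfold bd
  positivity

lemma bd_summable (d : ℕ) : Summable fun n : ℕ => bd d n / ((n : ℝ) + 1) := by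
  have hs1 : Summable fun n : ℕ => ((n : ℝ) + 1) ^ (-(3 / 2) : ℝ) := by
    have h := (summable_nat_add_iff 1).mpr
      (Real.summable_nat_rpow (p := (-(3 / 2) : ℝ)) |>.mpr (by norm_num))
    simpa using h
  refine summable_of_isBigO_nat hs1 ?_
  have h := (hs_pow_isBigO d).mul
    (Asymptotics.isBigO_refl (fun n : ℕ => ((n : ℝ) + 1) ^ (-2 : ℝ)) Filter.atTop)
  refine (h.congr ?_ ?_)
  · intro n
    have : (0 : ℝ) < (n : ℝ) + 1 := by positivity
    unfold bd
    rw [Real.rpow_neg this.le]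
    norm_num
    field_simp
  · intro n
    have : (0 : ℝ) < (n : ℝ) + 1 := by positivity
    rw [← Real.rpow_add this]
    norm_num

lemma bd_tendsto (d : ℕ) : Filter.Tendsto (bd d) Filter.atTop (nhds 0) := by
  have h := (hs_pow_isBigO d).mul
    (Asymptotics.isBigO_refl (fun n : ℕ => ((n : ℝ) + 1) ^ (-1 : ℝ)) Filter.atTop)
  have h4 : Filter.Tendsto (fun n : ℕ => (n : ℝ) + 1) Filter.atTop Filter.atTop :=
    Filter.tendsto_atTop_add_const_right _ _ tendsto_natCast_atTop_atTop
  have h5 := (tendsto_rpow_neg_atTop (y := (1 / 2 : ℝ)) (by norm_num)).comp h4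
  refine Asymptotics.IsBigO.trans_tendsto (h.congr ?_ ?_) h5
  · intro n
    have : (0 : ℝ) < (n : ℝ) + 1 := by positivity
    unfold bd
    rw [Real.rpow_neg this.le, Real.rpow_one, div_eq_mul_inv]
  · intro n
    have : (0 : ℝ) < (n : ℝ) + 1 := by positivity
    simp only [Function.comp]
    rw [← Real.rpow_add this]
    norm_num

def BD (s : ℕ → ℝ) : Prop := ∃ d, ∀ n, 0 ≤ s n ∧ s n ≤ bd d n

lemma BD.nonneg {s : ℕ → ℝ} (h : BD s) (n : ℕ) : 0 ≤ s n := by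
  obtain ⟨d, hd⟩ := h
  exact (hd n).1

lemma BD.mono {s t : ℕ → ℝ} (h : BD s) (h0 : ∀ n, 0 ≤ t n) (h1 : ∀ n, t n ≤ s n) : BD t := by
  obtain ⟨d, hd⟩ := h
  exact ⟨d, fun n => ⟨h0 n, (h1 n).trans (hd n).2⟩⟩

lemma BD.summable {s : ℕ → ℝ} (h : BD s) : Summable fun n : ℕ => s n / ((n : ℝ) + 1) := by
  obtain ⟨d, hd⟩ := h
  refine Summable.of_nonneg_of_le (fun n => ?_) (fun n => ?_) (bd_summable d)
  · have := (hd n).1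
    positivity
  · have := (hd n).2
    gcongr

lemma BD.tendsto {s : ℕ → ℝ} (h : BD s) : Filter.Tendsto s Filter.atTop (nhds 0) := by
  obtain ⟨d, hd⟩ := h
  exact squeeze_zero (fun n => (hd n).1) (fun n => (hd n).2) (bd_tendsto d)

def opX (s : ℕ → ℝ) : ℕ → ℝ := fun n => s n / ((n : ℝ) + 1)
def opY (s : ℕ → ℝ) : ℕ → ℝ := fun n => (∑ m ∈ Finset.range n, s m) / ((n : ℝ) + 1)
def opYs (s : ℕ → ℝ) : ℕ → ℝ := fun n => (∑ m ∈ Finset.range (n + 1), s m) / ((n : ℝ) + 1)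

lemma opYs_eq (s : ℕ → ℝ) : opYs s = opX s + opY s := by
  funext n
  simp only [opYs, opX, opY, Pi.add_apply, Finset.sum_range_succ]
  ring

lemma BD.opX {s : ℕ → ℝ} (h : BD s) : BD (opX s) := by
  refine h.mono (fun n => ?_) (fun n => ?_)
  · have := h.nonneg n
    unfold _root_.opX
    positivity
  · have := h.nonneg n
    unfold _root_.opX
    exact div_le_self this (by linarith [(Nat.cast_nonneg n : (0 : ℝ) ≤ n)])

lemma sum_bd_le (d n : ℕ) : ∑ m ∈ Finset.range (n + 1), bd d m ≤ hs n ^ (d + 1) := by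
  calc ∑ m ∈ Finset.range (n + 1), bd d m
      ≤ ∑ m ∈ Finset.range (n + 1), hs n ^ d * (1 / ((m : ℝ) + 1)) := by
        refine Finset.sum_le_sum fun m hm => ?_
        have h1 : hs m ≤ hs n := hs_mono (by simp at hm; omega)
        have h2 := one_le_hs m
        unfold bd
        rw [mul_one_div]
        gcongr
    _ = hs n ^ (d + 1) := by rw [← Finset.mul_sum, pow_succ]; rfl

lemma BD.opYs {s : ℕ → ℝ} (h : BD s) : BD (opYs s) := by
  obtain ⟨d, hd⟩ := h
  refine ⟨d + 1, fun n => ⟨?_, ?_⟩⟩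
  · unfold _root_.opYs
    have := Finset.sum_nonneg (s := Finset.range (n + 1)) fun m _ => (hd m).1
    positivity
  · unfold _root_.opYs
    have := (Finset.sum_le_sum (s := Finset.range (n + 1)) fun m _ => (hd m).2).trans (sum_bd_le d n)
    unfold bd
    gcongr

lemma BD.opY {s : ℕ → ℝ} (h : BD s) : BD (opY s) := by
  refine h.opYs.mono (fun n => ?_) (fun n => ?_)
  · unfold _root_.opY
    have := Finset.sum_nonneg (s := Finset.range n) fun m _ => h.nonneg m
    positivity
  · rw [opYs_eq]
    have := h.opX.nonneg n
    simp only [Pi.add_apply]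
    linarith

/-! ### Arrays -/

def opA (p : ℕ → ℕ → ℝ) (n : ℕ) : ℕ → ℝ
  | 0 => p n 0 / ((n : ℝ) + 1)
  | M + 1 => (((M : ℝ) + 1) * opA p n M + p n (M + 1)) / ((n : ℝ) + (M : ℝ) + 2)

def swp (p : ℕ → ℕ → ℝ) : ℕ → ℕ → ℝ := fun n M => p M n

def opB (p : ℕ → ℕ → ℝ) : ℕ → ℕ → ℝ := swp (opA (swp p))

structure Arr (p : ℕ → ℕ → ℝ) : Prop where
  nn : ∀ n M, 0 ≤ p n M
  rc : ∀ n M, p n M = p (n + 1) M + p n (M + 1)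

lemma Arr.swp {p : ℕ → ℕ → ℝ} (h : Arr p) : Arr (swp p) :=
  ⟨fun n M => h.nn M n, fun n M => by
    have := h.rc M n
    unfold _root_.swp
    linarith⟩

lemma opA_zero (p : ℕ → ℕ → ℝ) (n : ℕ) : opA p n 0 = p n 0 / ((n : ℝ) + 1) := rfl

lemma opA_succ (p : ℕ → ℕ → ℝ) (n M : ℕ) :
    ((n : ℝ) + (M : ℝ) + 2) * opA p n (M + 1) = ((M : ℝ) + 1) * opA p n M + p n (M + 1) := by
  have : (0 : ℝ) < (n : ℝ) + (M : ℝ) + 2 := by positivity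
  rw [opA]
  field_simp

lemma Arr.opA {p : ℕ → ℕ → ℝ} (h : Arr p) : Arr (opA p) := by
  constructor
  · intro n M
    induction M with
    | zero =>
      rw [opA_zero]
      have := h.nn n 0
      positivity
    | succ M ih =>
      rw [_root_.opA]
      have := h.nn n (M + 1)
      positivity
  · intro n M
    induction M with
    | zero =>
      have h1 := opA_succ p n 0
      have h2 := h.rc n 0
      rw [opA_zero] at h1 ⊢
      rw [opA_zero]
      push_cast at *
      have e1 : (0 : ℝ) < (n : ℝ) + 1 := by positivity
      have e2 : (0 : ℝ) < (n : ℝ) + 2 := by positivity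
      have h3 : _root_.opA p n (0 + 1) = (p n 0 / ((n : ℝ) + 1) + p n (0 + 1)) / ((n : ℝ) + 2) := by
        rw [eq_div_iff e2.ne']
        linarith
      rw [h3, show p n (0 + 1) = p n 0 - p (n + 1) 0 by linarith]
      have e3 : (n : ℝ) + 1 + 1 = (n : ℝ) + 2 := by ring
      rw [e3]
      field_simp
      ring
    | succ M ih =>
      have h1 := opA_succ p (n + 1) M
      have h2 := opA_succ p n (M + 1)
      have h3 := h.rc n (M + 1)
      have h4 := opA_succ p n M
      push_cast at *
      have e1 : (0 : ℝ) < (n : ℝ) + (M : ℝ) + 3 := by positivity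
      have : ((n : ℝ) + (M : ℝ) + 3) * (_root_.opA p n (M + 1)) =
          ((n : ℝ) + (M : ℝ) + 3) *
            (_root_.opA p (n + 1) (M + 1) + _root_.opA p n (M + 1 + 1)) := by
        linear_combination (-1) * h1 - h2 + ((M : ℝ) + 1) * ih + h3 + h4
      exact mul_left_cancel₀ e1.ne' this

lemma Arr.opB {p : ℕ → ℕ → ℝ} (h : Arr p) : Arr (opB p) := h.swp.opA.swp

lemma opA_alt {p : ℕ → ℕ → ℝ} (h : Arr p) (n M : ℕ) :
    ((n : ℝ) + 1) * opA p n (M + 1) - ((M : ℝ) + 1) * opA p (n + 1) M = p n (M + 1) := by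
  have h1 := opA_succ p n M
  have h2 := h.opA.rc n M
  linear_combination h1 + ((M : ℝ) + 1) * h2

lemma opA_row (p : ℕ → ℕ → ℝ) : opA p 0 = opYs (p 0) := by
  have key : ∀ M : ℕ, ((M : ℝ) + 1) * opA p 0 M = ∑ m ∈ Finset.range (M + 1), p 0 m := by
    intro M
    induction M with
    | zero => simp [opA_zero]
    | succ M ih =>
      rw [Finset.sum_range_succ, ← ih]
      have := opA_succ p 0 M
      push_cast at *
      linarith
  funext M
  have e1 : (0 : ℝ) < (M : ℝ) + 1 := by positivity
  unfold opYs
  rw [← key]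
  field_simp

lemma opA_col (p : ℕ → ℕ → ℝ) : (fun n => opA p n 0) = opX (fun n => p n 0) := rfl
lemma opB_row (p : ℕ → ℕ → ℝ) : opB p 0 = opX (p 0) := rfl
lemma opB_col (p : ℕ → ℕ → ℝ) : (fun n => opB p n 0) = opYs (fun n => p n 0) := opA_row (swp p)

lemma Arr.le_col {p : ℕ → ℕ → ℝ} (h : Arr p) (n M : ℕ) : p n M ≤ p n 0 := by
  induction M with
  | zero => exact le_rfl
  | succ M ih => linarith [h.rc n M, h.nn (n + 1) M]

lemma Arr.le_row {p : ℕ → ℕ → ℝ} (h : Arr p) (n M : ℕ) : p n M ≤ p 0 M := h.swp.le_col M n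

/-- Arrays with a bounded column. -/
structure Good (p : ℕ → ℕ → ℝ) : Prop extends Arr p where
  bc : BD (fun n => p n 0)

lemma Good.opA {p : ℕ → ℕ → ℝ} (h : Good p) : Good (opA p) :=
  ⟨h.toArr.opA, by rw [opA_col]; exact h.bc.opX⟩

lemma Good.opB {p : ℕ → ℕ → ℝ} (h : Good p) : Good (opB p) :=
  ⟨h.toArr.opB, by rw [opB_col]; exact h.bc.opYs⟩

lemma Good.bcol {p : ℕ → ℕ → ℝ} (h : Good p) (M : ℕ) : BD (fun n => p n M) :=
  h.bc.mono (fun n => h.nn n M) (fun n => h.le_col n M)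

lemma Good.lim {p : ℕ → ℕ → ℝ} (h : Good p) (M : ℕ) :
    Filter.Tendsto (fun n => p n M) Filter.atTop (nhds 0) := (h.bcol M).tendsto

lemma Good.summ {p : ℕ → ℕ → ℝ} (h : Good p) (M : ℕ) :
    Summable fun n : ℕ => p n M / ((n : ℝ) + 1) := (h.bcol M).summable

lemma Good.summ' {p : ℕ → ℕ → ℝ} (h : Good p) (M : ℕ) :
    Summable fun n : ℕ => p (n + 1) M / ((n : ℝ) + 1) := by
  refine Summable.of_nonneg_of_le (fun n => ?_) (fun n => ?_) (h.summ M)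
  · have := h.nn (n + 1) M
    positivity
  · have : p (n + 1) M ≤ p n M := by linarith [h.rc n M, h.nn n (M + 1)]
    gcongr

def EE (p : ℕ → ℕ → ℝ) (N : ℕ) : ℝ := ∑' n : ℕ, p n N / ((n : ℝ) + 1)
def TT (p : ℕ → ℕ → ℝ) (M : ℕ) : ℝ := ∑' n : ℕ, p (n + 1) M / ((n : ℝ) + 1)

lemma Good.EE_sub {p : ℕ → ℕ → ℝ} (h : Good p) (M : ℕ) : EE p M - EE p (M + 1) = TT p M := by
  unfold EE TT
  rw [← (h.summ M).tsum_sub (h.summ (M + 1))]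
  congr 1
  funext n
  rw [h.rc n M]
  ring

lemma Good.TT_nonneg {p : ℕ → ℕ → ℝ} (h : Good p) (M : ℕ) : 0 ≤ TT p M :=
  tsum_nonneg fun n => by
    have := h.nn (n + 1) M
    positivity

lemma Good.EE_tendsto {p : ℕ → ℕ → ℝ} (h : Good p) (hr : BD (p 0)) :
    Filter.Tendsto (EE p) Filter.atTop (nhds 0) := by
  have := tendsto_tsum_of_dominated_convergence (𝓕 := Filter.atTop)
    (f := fun N n : ℕ => p n N / ((n : ℝ) + 1)) (g := fun _ => (0 : ℝ)) (h.summ 0)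
    (fun n => by
      have h1 : Filter.Tendsto (fun N => p n N) Filter.atTop (nhds 0) :=
        squeeze_zero (fun N => h.nn n N) (fun N => h.le_row n N) hr.tendsto
      simpa using h1.div_const ((n : ℝ) + 1))
    (Filter.Eventually.of_forall fun N n => by
      have := h.nn n N
      rw [Real.norm_of_nonneg (by positivity)]
      have := h.le_col n N
      gcongr)
  simp only [tsum_zero] at this
  exact this

lemma Good.hasSum_TT {p : ℕ → ℕ → ℝ} (h : Good p) (hr : BD (p 0)) (N : ℕ) :
    HasSum (fun m => TT p (N + m)) (EE p N) := by
  rw [hasSum_iff_tendsto_nat_of_nonneg (fun m => h.TT_nonneg _)]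
  have h1 : ∀ K, ∑ m ∈ Finset.range K, TT p (N + m) = EE p N - EE p (N + K) := by
    intro K
    induction K with
    | zero => simp
    | succ K ih =>
      rw [Finset.sum_range_succ, ih, ← h.EE_sub (N + K)]
      ring_nf
  simp only [h1]
  have h2 : Filter.Tendsto (fun K => EE p (N + K)) Filter.atTop (nhds 0) :=
    (h.EE_tendsto hr).comp (Filter.tendsto_atTop_mono (fun K => Nat.le_add_left K N) Filter.tendsto_id)
  simpa using h2.const_sub (EE p N)

lemma hasSum_congr_aux {f g : ℕ → ℝ} {a : ℝ} (h : ∀ n, f n = g n) : HasSum f a ↔ HasSum g a := by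
  rw [funext h]

lemma hasSum_tele {f : ℕ → ℝ} (hf : Filter.Tendsto f Filter.atTop (nhds 0))
    (hm : ∀ n, f (n + 1) ≤ f n) : HasSum (fun n => f n - f (n + 1)) (f 0) := by
  rw [hasSum_iff_tendsto_nat_of_nonneg (fun n => by linarith [hm n])]
  simp only [Finset.sum_range_sub']
  simpa using hf.const_sub (f 0)

lemma Good.TT_opA {p : ℕ → ℕ → ℝ} (h : Good p) (M : ℕ) :
    ((M : ℝ) + 1) * TT (_root_.opA p) M = _root_.opA p 0 M - EE p (M + 1) := by
  have h1 : HasSum (fun n => _root_.opA p n M - _root_.opA p (n + 1) M) (_root_.opA p 0 M) :=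
    hasSum_tele (h.opA.lim M) fun n => by linarith [h.opA.rc n M, h.opA.nn n (M + 1)]
  have h2 := (h.opA.summ' M).hasSum.mul_left ((M : ℝ) + 1)
  have h3 := h1.sub h2
  have h4 := (h.summ (M + 1)).hasSum
  have h5 := h3.unique ((hasSum_congr_aux fun n => by
    have e1 : (0 : ℝ) < (n : ℝ) + 1 := by positivity
    have := opA_alt h.toArr n M
    have r := h.opA.rc n M
    rw [← this, show _root_.opA p n M - _root_.opA p (n + 1) M = _root_.opA p n (M + 1) by linarith]
    field_simp).mpr h4)
  unfold TT EE
  linarith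

lemma Good.TT_opB {p : ℕ → ℕ → ℝ} (h : Good p) (M : ℕ) :
    ((M : ℝ) + 1) * TT (_root_.opB p) M = _root_.opB p 0 M + TT p M := by
  have h1 : HasSum (fun n => _root_.opB p n M - _root_.opB p (n + 1) M) (_root_.opB p 0 M) :=
    hasSum_tele (h.opB.lim M) fun n => by linarith [h.opB.rc n M, h.opB.nn n (M + 1)]
  have h2 := (h.opB.summ' M).hasSum.mul_left ((M : ℝ) + 1)
  have h4 := (h.summ' M).hasSum
  have h3 := h1.add h4
  refine h2.unique ((hasSum_congr_aux fun n => ?_).mpr h3)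
  have e1 : (0 : ℝ) < (n : ℝ) + 1 := by positivity
  have := opA_succ (_root_.swp p) M n
  change _ * _root_.opB p (n + 1) M = _ * _root_.opB p n M + p (n + 1) M at this
  field_simp
  linarith

def dlt : ℕ → ℕ → ℝ := fun n _ => if n = 0 then 1 else 0

lemma dlt_good : Good dlt := by
  refine ⟨⟨fun n M => ?_, fun n M => ?_⟩, ⟨0, fun n => ?_⟩⟩
  · unfold dlt
    split_ifs <;> norm_num
  · simp [dlt]
  · simp only [dlt, bd]
    split_ifs with h
    · subst h
      simp
    · refine ⟨le_rfl, ?_⟩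
      positivity

lemma iterB {p : ℕ → ℕ → ℝ} (h : Good p) (c : ℕ) :
    Good (opB^[c] p) ∧ (∀ M, opB^[c] p 0 M = p 0 M / ((M : ℝ) + 1) ^ c) ∧
    (∀ M, TT (opB^[c] p) M = TT p M / ((M : ℝ) + 1) ^ c
        + c * (p 0 M / ((M : ℝ) + 1) ^ (c + 1))) ∧ (BD (p 0) → BD (opB^[c] p 0)) := by
  induction c with
  | zero => simpa using h
  | succ c ih =>
    obtain ⟨h1, h2, h3, h4⟩ := ih
    simp only [Function.iterate_succ_apply']
    refine ⟨h1.opB, fun M => ?_, fun M => ?_, fun hp => ?_⟩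
    · rw [opB_row]
      unfold opX
      rw [h2, pow_succ, div_div]
    · have e1 : (0 : ℝ) < (M : ℝ) + 1 := by positivity
      have h5 := h1.TT_opB M
      rw [opB_row] at h5
      unfold opX at h5
      rw [h2, h3] at h5
      refine mul_left_cancel₀ e1.ne' (h5.trans ?_)
      push_cast
      field_simp
      ring
    · rw [opB_row]
      exact (h4 hp).opX

def PP (k : ℕ → ℕ) : ℕ → ℕ → ℕ → ℝ
  | 0 => opB^[k 0] dlt
  | r + 1 => opB^[k (r + 1) - 1] (opA (PP k r))

lemma PP_good (k : ℕ → ℕ) (hk : ∀ i, 1 ≤ k i) (r : ℕ) : Good (PP k r) ∧ BD (PP k r 0) := by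
  induction r with
  | zero =>
    unfold PP
    refine ⟨(iterB dlt_good (k 0)).1, ?_⟩
    obtain ⟨c, hc⟩ : ∃ c, k 0 = c + 1 := ⟨k 0 - 1, by have := hk 0; omega⟩
    rw [hc, Function.iterate_succ_apply]
    refine (iterB dlt_good.opB c).2.2.2 ⟨0, fun n => ?_⟩
    rw [opB_row]
    simp only [opX, dlt, bd]
    simp
    positivity
  | succ r ih =>
    rw [PP]
    have h := iterB ih.1.opA (k (r + 1) - 1)
    refine ⟨h.1, h.2.2.2 ?_⟩
    rw [opA_row]
    exact ih.2.opYs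
/-! ### Chains -/

open Classical in
def chF (R : ℕ → ℕ → ℕ → Prop) (w : ℕ → ℕ → ENNReal) (r : ℕ) (n : Fin (r + 1) → ℕ) : ENNReal :=
  if (∀ (i : ℕ) (h : i + 1 < r + 1), R i (n ⟨i, by omega⟩) (n ⟨i + 1, h⟩))
  then ∏ i, w i.val (n i) else 0

open Classical in
def chC (R : ℕ → ℕ → ℕ → Prop) (w : ℕ → ℕ → ENNReal) : ℕ → ℕ → ENNReal
  | 0, N => w 0 N
  | r + 1, N => w (r + 1) N * ∑' M, if R r M N then chC R w r M else 0

open Classical in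
lemma chF_snoc (R : ℕ → ℕ → ℕ → Prop) (w : ℕ → ℕ → ENNReal) (r : ℕ) (m : Fin (r + 1) → ℕ) (N : ℕ) :
    chF R w (r + 1) (Fin.snoc (α := fun _ => ℕ) m N)
      = w (r + 1) N * (if R r (m (Fin.last r)) N then chF R w r m else 0) := by
  have hprod : ∏ i : Fin (r + 1 + 1), w i.val ((Fin.snoc (α := fun _ => ℕ) m N : Fin (r + 2) → ℕ) i)
      = (∏ i : Fin (r + 1), w i.val (m i)) * w (r + 1) N := by
    rw [Fin.prod_univ_castSucc]
    simp
  have e : ∀ (i : ℕ) (h : i < r + 1),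
      (Fin.snoc (α := fun _ => ℕ) m N : Fin (r + 2) → ℕ) ⟨i, by omega⟩ = m ⟨i, h⟩ := by
    intro i h
    exact Fin.snoc_castSucc (α := fun _ => ℕ) (x := N) (p := m) (i := ⟨i, h⟩)
  have el : (Fin.snoc (α := fun _ => ℕ) m N : Fin (r + 2) → ℕ) ⟨r + 1, by omega⟩ = N :=
    Fin.snoc_last (α := fun _ => ℕ) (x := N) (p := m)
  have hiff : (∀ (i : ℕ) (h : i + 1 < r + 1 + 1),
      R i ((Fin.snoc (α := fun _ => ℕ) m N : Fin (r + 2) → ℕ) ⟨i, by omega⟩)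
        ((Fin.snoc (α := fun _ => ℕ) m N : Fin (r + 2) → ℕ) ⟨i + 1, h⟩)) ↔
      R r (m (Fin.last r)) N ∧
      (∀ (i : ℕ) (h : i + 1 < r + 1), R i (m ⟨i, by omega⟩) (m ⟨i + 1, h⟩)) := by
    constructor
    · intro H0
      refine ⟨?_, fun i h => ?_⟩
      · have := H0 r (by omega)
        rw [el, e r (by omega)] at this
        exact this
      · have := H0 i (by omega)
        rw [e i (by omega), e (i + 1) (by omega)] at this
        exact this
    · rintro ⟨h1, h2⟩ i h
      by_cases hi : i = r
      · subst hi
        rw [el, e i (by omega)]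
        exact h1
      · rw [e i (by omega), e (i + 1) (by omega)]
        exact h2 i (by omega)
  unfold chF
  rw [hprod]
  simp only [hiff]
  by_cases h1 : R r (m (Fin.last r)) N
  · simp only [h1, true_and, if_true]
    split_ifs
    · rw [mul_comm]
    · simp
  · simp [h1]

lemma tsum_snoc (r : ℕ) (f : (Fin (r + 1) → ℕ) → ENNReal) :
    ∑' n, f n = ∑' N, ∑' m : Fin r → ℕ, f (Fin.snoc (α := fun _ => ℕ) m N) := by
  rw [← (Fin.snocEquiv (fun _ : Fin (r + 1) => ℕ)).tsum_eq f, ENNReal.tsum_prod']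
  rfl

open Classical in
lemma chF_tsum_aux (R : ℕ → ℕ → ℕ → Prop) (w : ℕ → ℕ → ENNReal) (r : ℕ) (N : ℕ) :
    ∑' m : Fin r → ℕ, chF R w r (Fin.snoc (α := fun _ => ℕ) m N) = chC R w r N := by
  induction r generalizing N with
  | zero =>
    rw [tsum_eq_single default (fun b hb => (hb (Subsingleton.elim _ _)).elim)]
    have : ∀ (i : ℕ) (h : i + 1 < 0 + 1), False := fun i h => by omega
    simp [chF, chC, Fin.snoc]
  | succ r ih =>
    simp only [chF_snoc]
    rw [ENNReal.tsum_mul_left, tsum_snoc, chC]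
    congr 1
    refine tsum_congr fun M => ?_
    simp only [Fin.snoc_last]
    split_ifs
    · exact ih M
    · simp

lemma chF_tsum (R : ℕ → ℕ → ℕ → Prop) (w : ℕ → ℕ → ENNReal) (r : ℕ) :
    ∑' n : Fin (r + 1) → ℕ, chF R w r n = ∑' N, chC R w r N := by
  rw [tsum_snoc]
  exact tsum_congr fun N => chF_tsum_aux R w r N

/-! ### Multiple zeta values as chains -/

def wz (k : ℕ → ℕ) (i n : ℕ) : ENNReal := ENNReal.ofReal (1 / (n : ℝ) ^ k i)

def Mc (k : ℕ → ℕ) : ℕ → ℕ → ℝ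
  | 0, N => 1 / (N : ℝ) ^ k 0
  | r + 1, N => 1 / (N : ℝ) ^ k (r + 1) * ∑ M ∈ Finset.range N, Mc k r M

lemma Mc_nonneg (k : ℕ → ℕ) (r N : ℕ) : 0 ≤ Mc k r N := by
  induction r generalizing N with
  | zero =>
    unfold Mc
    positivity
  | succ r ih =>
    unfold Mc
    have := Finset.sum_nonneg (s := Finset.range N) fun M _ => ih M
    positivity

lemma Mc_zero (k : ℕ → ℕ) (hk : ∀ i, 1 ≤ k i) (r : ℕ) : Mc k r 0 = 0 := by
  cases r with
  | zero =>
    have := hk 0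
    simp [Mc, zero_pow (show k 0 ≠ 0 by omega)]
  | succ r => simp [Mc]

lemma Mc_congr (k k' : ℕ → ℕ) (r : ℕ) (h : ∀ i ≤ r, k i = k' i) (N : ℕ) : Mc k r N = Mc k' r N := by
  induction r generalizing N with
  | zero => simp [Mc, h 0]
  | succ r ih =>
    unfold Mc
    rw [h (r + 1) le_rfl]
    congr 1
    exact Finset.sum_congr rfl fun M _ => ih (fun i hi => h i (by omega)) M

lemma tsum_if_lt (f : ℕ → ℝ) (hf : ∀ n, 0 ≤ f n) (N : ℕ) :
    (∑' M, if M < N then ENNReal.ofReal (f M) else 0)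
      = ENNReal.ofReal (∑ M ∈ Finset.range N, f M) := by
  rw [tsum_eq_sum (s := Finset.range N)]
  · rw [ENNReal.ofReal_sum_of_nonneg (fun i _ => hf i)]
    refine Finset.sum_congr rfl fun M hM => ?_
    rw [if_pos (by simpa using hM)]
  · intro M hM
    rw [if_neg (by simpa using hM)]

lemma chC_Mc (k : ℕ → ℕ) (r N : ℕ) :
    chC (fun _ a b => a < b) (wz k) r N = ENNReal.ofReal (Mc k r N) := by
  induction r generalizing N with
  | zero => rfl
  | succ r ih =>
    unfold chC Mc
    simp only [ih]
    rw [ENNReal.ofReal_mul (by positivity), ← tsum_if_lt _ (Mc_nonneg k r)]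
    unfold wz
    congr 1

lemma tsum_shift (f : ℕ → ℝ) (h0 : f 0 = 0) : ∑' n, f n = ∑' n, f (n + 1) := by
  have hinj : Function.Injective (fun n : ℕ => n + 1) := fun a b h => by simpa using h
  rw [← hinj.tsum_eq (f := f)]
  intro n hn
  cases n with
  | zero => exact (hn h0).elim
  | succ n => exact ⟨n, rfl⟩

lemma MZV_eq (k : ℕ → ℕ) (hk : ∀ i, 1 ≤ k i) (r : ℕ) :
    MZV (r + 1) (fun i => k i.val) = ∑' n, Mc k r (n + 1) := by
  classical
  have h1 : ∑' n : Fin (r + 1) → ℕ, (chF (fun _ a b => a < b) (wz k) r n).toReal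
      = ∑' n, Mc k r (n + 1) := by
    rw [← ENNReal.tsum_toReal_eq, chF_tsum, ENNReal.tsum_toReal_eq]
    · simp only [chC_Mc, ENNReal.toReal_ofReal (Mc_nonneg k r _)]
      exact tsum_shift _ (Mc_zero k hk r)
    · intro a
      simp [chC_Mc]
    · intro a
      unfold chF
      split_ifs
      · exact ENNReal.prod_ne_top fun i _ => ENNReal.ofReal_ne_top
      · simp
  rw [← h1]
  unfold MZV
  refine (tsum_subtype {n : Fin (r + 1) → ℕ | (∀ i, 0 < n i) ∧ StrictMono n}
    (fun n => ∏ i, (1 : ℝ) / (n i : ℝ) ^ (k i.val))).trans ?_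
  refine tsum_congr fun n => ?_
  have hsm : StrictMono n ↔
      ∀ (i : ℕ) (h : i + 1 < r + 1), n ⟨i, by omega⟩ < n ⟨i + 1, h⟩ := by
    rw [Fin.strictMono_iff_lt_succ]
    constructor
    · intro h i hi
      exact h ⟨i, by omega⟩
    · intro h i
      exact h i.val (by omega)
  have hP : (∏ i : Fin (r + 1), wz k i.val (n i)).toReal
      = ∏ i : Fin (r + 1), (1 : ℝ) / (n i : ℝ) ^ (k i.val) := by
    rw [ENNReal.toReal_prod]
    refine Finset.prod_congr rfl fun i _ => ?_
    unfold wz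
    rw [ENNReal.toReal_ofReal (by positivity)]
  unfold chF
  rw [← hsm]
  by_cases h2 : StrictMono n
  · rw [if_pos h2, hP]
    by_cases h3 : ∀ i, 0 < n i
    · exact Set.indicator_of_mem (show n ∈ {n : Fin (r + 1) → ℕ | (∀ i, 0 < n i) ∧ StrictMono n} from ⟨h3, h2⟩) _
    · rw [Set.indicator_of_notMem (fun h => h3 h.1)]
      push Not at h3
      obtain ⟨i, hi⟩ := h3
      symm
      refine Finset.prod_eq_zero (Finset.mem_univ i) ?_
      have := hk i.val
      rw [show n i = 0 by omega]
      simp [zero_pow (show k i.val ≠ 0 by omega)]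
  · rw [if_neg h2, Set.indicator_of_notMem (fun h => h2 h.2)]
    simp

/-! ### Words -/

def wd (v : List Bool) : H := (v.map fun b => if b then Hy else Hx).prod

def sop : List Bool → (ℕ → ℝ) → ℕ → ℝ
  | [], s => s
  | b :: v, s => sop v (if b then opY s else opX s)

lemma sop_append (v : List Bool) (b : Bool) (s : ℕ → ℝ) :
    sop (v ++ [b]) s = if b then opY (sop v s) else opX (sop v s) := by
  induction v generalizing s with
  | nil => rfl
  | cons c v ih => exact ih _

lemma opX_add (s t : ℕ → ℝ) : opX (s + t) = opX s + opX t := by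
  funext n
  simp only [opX, Pi.add_apply]
  ring

lemma opY_add (s t : ℕ → ℝ) : opY (s + t) = opY s + opY t := by
  funext n
  simp only [opY, Pi.add_apply, Finset.sum_add_distrib]
  ring

lemma sop_add (v : List Bool) (s t : ℕ → ℝ) : sop v (s + t) = sop v s + sop v t := by
  induction v generalizing s t with
  | nil => rfl
  | cons c v ih =>
    cases c
    · simp only [sop, opX_add, Bool.false_eq_true, if_false, ih]
    · simp only [sop, opY_add, if_true, ih]

lemma BD.sop {s : ℕ → ℝ} (h : BD s) (v : List Bool) : BD (sop v s) := by
  induction v generalizing s with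
  | nil => exact h
  | cons c v ih =>
    cases c
    · exact ih h.opX
    · exact ih h.opY

def ihp (k : ℕ → ℕ) (r : ℕ) : H :=
  (List.ofFn fun i : Fin (r + 1) => Hy * Hx ^ (k i.val - 1)).prod

lemma ihp_zero (k : ℕ → ℕ) : ihp k 0 = Hy * Hx ^ (k 0 - 1) := by
  simp [ihp]

lemma ihp_succ (k : ℕ → ℕ) (r : ℕ) : ihp k (r + 1) = ihp k r * (Hy * Hx ^ (k (r + 1) - 1)) := by
  unfold ihp
  rw [List.ofFn_succ', List.concat_eq_append, List.prod_append]
  simp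

lemma ihp_congr (k k' : ℕ → ℕ) (r : ℕ) (h : ∀ i ≤ r, k i = k' i) : ihp k r = ihp k' r := by
  unfold ihp
  congr 2
  funext i
  rw [h i.val (by omega)]

lemma ihp_mul_x (k : ℕ → ℕ) (hk : ∀ i, 1 ≤ k i) (r : ℕ) :
    ihp (Function.update k r (k r + 1)) r = ihp k r * Hx := by
  obtain ⟨c, hc⟩ : ∃ c, k r = c + 1 := ⟨k r - 1, by have := hk r; omega⟩
  cases r with
  | zero =>
    simp [ihp_zero, hc, pow_succ, mul_assoc]
  | succ r =>
    rw [ihp_succ, ihp_succ, ihp_congr (Function.update k (r + 1) (k (r + 1) + 1)) k r]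
    · simp [hc, pow_succ, mul_assoc]
    · intro i hi
      rw [Function.update_of_ne (by omega)]

lemma Mc_mul_x (k : ℕ → ℕ) (r N : ℕ) :
    Mc (Function.update k r (k r + 1)) r N = Mc k r N / (N : ℝ) := by
  cases r with
  | zero => simp [Mc, pow_succ]; ring
  | succ r =>
    unfold Mc
    rw [Finset.sum_congr rfl fun M _ => Mc_congr (Function.update k (r + 1) (k (r + 1) + 1)) k r
      (fun i hi => by rw [Function.update_of_ne (by omega)]) M]
    simp only [Function.update_self, pow_succ]
    rw [one_div, one_div, mul_inv]
    ring

lemma update_pos (k : ℕ → ℕ) (hk : ∀ i, 1 ≤ k i) (r c : ℕ) (hc : 1 ≤ c) (i : ℕ) :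
    1 ≤ Function.update k r c i := by
  rw [Function.update_apply]
  split_ifs
  · exact hc
  · exact hk i

def s0 : ℕ → ℝ := fun n => 1 / ((n : ℝ) + 1)

lemma s0_BD : BD s0 := ⟨0, fun n => ⟨by unfold s0; positivity, by simp [s0, bd]⟩⟩

lemma word_index (v : List Bool) : ∃ (r : ℕ) (k : ℕ → ℕ), (∀ i, 1 ≤ k i) ∧
    Hy * wd v = ihp k r ∧ ∀ n, sop v s0 n = Mc k r (n + 1) := by
  induction v using List.reverseRecOn with
  | nil =>
    refine ⟨0, fun _ => 1, fun _ => le_rfl, ?_, fun n => ?_⟩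
    · simp [wd, ihp_zero]
    · simp [sop, s0, Mc]
  | append_singleton v b ih =>
    obtain ⟨r, k, hk, h1, h2⟩ := ih
    have hw : Hy * wd (v ++ [b]) = ihp k r * (if b then Hy else Hx) := by
      rw [← h1]
      simp [wd, mul_assoc]
    rw [hw]
    simp only [sop_append]
    cases b
    · refine ⟨r, Function.update k r (k r + 1), update_pos k hk r _ (by omega), ?_, fun n => ?_⟩
      · rw [ihp_mul_x k hk]
        simp
      · rw [Mc_mul_x]
        simp [opX, h2]
    · refine ⟨r + 1, Function.update k (r + 1) 1, update_pos k hk _ _ le_rfl, ?_, fun n => ?_⟩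
      · rw [ihp_succ, ihp_congr (Function.update k (r + 1) 1) k r]
        · simp
        · intro i hi
          rw [Function.update_of_ne (by omega)]
      · rw [Mc, Finset.sum_congr rfl fun M _ => Mc_congr (Function.update k (r + 1) 1) k r
          (fun i hi => by rw [Function.update_of_ne (by omega)]) M]
        rw [Finset.sum_range_succ', Mc_zero k hk]
        simp [opY, h2]
        ring

lemma Z_word (Z : H →ₗ[ℚ] ℝ) (hZ : IsZetaMap Z) (v : List Bool) :
    Z (Hy * wd v * Hx) = ∑' n : ℕ, sop v s0 n / ((n : ℝ) + 1) := by
  obtain ⟨r, k, hk, h1, h2⟩ := word_index v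
  rw [h1, ← ihp_mul_x k hk]
  have hk' := update_pos k hk r (k r + 1) (by omega)
  have h3 := hZ r (fun i => Function.update k r (k r + 1) i.val) (fun i => hk' i.val)
    (by simpa using hk r)
  unfold ihp
  rw [h3, MZV_eq _ hk']
  refine tsum_congr fun n => ?_
  rw [Mc_mul_x, h2]
  push_cast
  rfl

def ZRel (Z : H →ₗ[ℚ] ℝ) (u : H) (s : ℕ → ℝ) : Prop :=
  BD s ∧ ∀ v, Z (Hy * S1 u * wd v * Hx) = ∑' n : ℕ, sop v s n / ((n : ℝ) + 1)

lemma S1x : S1 Hx = Hx := by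
  simp [S1, Hx]

lemma S1y : S1 Hy = Hx + Hy := by
  simp [S1, Hy]

lemma wd_cons (b : Bool) (v : List Bool) : wd (b :: v) = (if b then Hy else Hx) * wd v := by
  simp [wd]

lemma ZRel_one (Z : H →ₗ[ℚ] ℝ) (hZ : IsZetaMap Z) : ZRel Z 1 s0 :=
  ⟨s0_BD, fun v => by rw [map_one, mul_one]; exact Z_word Z hZ v⟩

lemma ZRel.x {Z : H →ₗ[ℚ] ℝ} {u : H} {s : ℕ → ℝ} (h : ZRel Z u s) : ZRel Z (u * Hx) (opX s) := by
  refine ⟨h.1.opX, fun v => ?_⟩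
  have := h.2 (false :: v)
  rw [wd_cons] at this
  rw [map_mul S1, S1x]
  simpa [mul_assoc, sop] using this

lemma ZRel.y {Z : H →ₗ[ℚ] ℝ} {u : H} {s : ℕ → ℝ} (h : ZRel Z u s) : ZRel Z (u * Hy) (opYs s) := by
  refine ⟨h.1.opYs, fun v => ?_⟩
  have h1 := h.2 (false :: v)
  have h2 := h.2 (true :: v)
  rw [wd_cons] at h1 h2
  rw [map_mul S1, S1y]
  have e : Hy * (S1 u * (Hx + Hy)) * wd v * Hx
      = Hy * S1 u * (Hx * wd v) * Hx + Hy * S1 u * (Hy * wd v) * Hx := by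
    noncomm_ring
  simp only [Bool.false_eq_true, if_false, if_true, sop] at h1 h2
  rw [e, map_add, h1, h2, opYs_eq, sop_add,
    ← (h.1.opX.sop v).summable.tsum_add (h.1.opY.sop v).summable]
  refine tsum_congr fun n => ?_
  simp only [Pi.add_apply]
  ring

lemma ZRel.ypow {Z : H →ₗ[ℚ] ℝ} {u : H} {p : ℕ → ℕ → ℝ} (h : ZRel Z u (fun n => p n 0)) (c : ℕ) :
    ZRel Z (u * Hy ^ c) (fun n => opB^[c] p n 0) := by
  induction c with
  | zero => simpa using h
  | succ c ih =>
    have := ih.y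
    simp only [Function.iterate_succ_apply']
    rw [opB_col, pow_succ, ← mul_assoc]
    exact this

lemma ZRel_PP {Z : H →ₗ[ℚ] ℝ} (hZ : IsZetaMap Z) (k : ℕ → ℕ) (hk : ∀ i, 1 ≤ k i) (r : ℕ) :
    ∃ u, (List.ofFn fun i : Fin (r + 1) => Hy ^ (k i.val - 1) * Hx).prod = u * Hx ∧
      ZRel Z u (fun n => PP k r n 0) := by
  induction r with
  | zero =>
    refine ⟨Hy ^ (k 0 - 1), by simp, ?_⟩
    obtain ⟨c, hc⟩ : ∃ c, k 0 = c + 1 := ⟨k 0 - 1, by have := hk 0; omega⟩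
    have h1 : ZRel Z 1 (fun n => opB dlt n 0) := by
      rw [opB_col]
      convert ZRel_one Z hZ using 1
      funext n
      simp [opYs, dlt, s0]
    have := h1.ypow c
    rw [PP, hc, Function.iterate_succ_apply]
    simpa using this
  | succ r ih =>
    obtain ⟨u, h1, h2⟩ := ih
    refine ⟨u * Hx * Hy ^ (k (r + 1) - 1), ?_, ?_⟩
    · rw [List.ofFn_succ', List.concat_eq_append, List.prod_append]
      simp only [Fin.val_castSucc, h1]
      simp [mul_assoc]
    · have h3 : ZRel Z (u * Hx) (fun n => opA (PP k r) n 0) := by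
        rw [opA_col]
        exact h2.x
      exact h3.ypow _

lemma LHS_eq {Z : H →ₗ[ℚ] ℝ} (hZ : IsZetaMap Z) (k : ℕ → ℕ) (hk : ∀ i, 1 ≤ k i) (r : ℕ) :
    Z (Hy * S1 ((List.ofFn fun i : Fin (r + 1) => Hy ^ (k i.val - 1) * Hx).prod))
      = EE (PP k r) 0 := by
  obtain ⟨u, h1, h2⟩ := ZRel_PP hZ k hk r
  have := h2.2 []
  rw [h1, map_mul S1, S1x, ← mul_assoc]
  simpa [wd, sop, EE] using this
/-! ### Up-down sums -/

def RU (j i a b : ℕ) : Prop := (i + 1 ≤ j → a ≤ b) ∧ (j ≤ i → b < a)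

def wu (k : ℕ → ℕ) (j i n : ℕ) : ENNReal :=
  ENNReal.ofReal ((if i = j then (k i : ℝ) / (n : ℝ) else 1) * (1 / (n : ℝ) ^ k i))

def UE (k : ℕ → ℕ) (j r N : ℕ) : ENNReal := chC (RU j) (wu k j) r N

def Vc (k : ℕ → ℕ) : ℕ → ℕ → ℝ
  | 0, N => 1 / (N : ℝ) ^ k 0
  | r + 1, N => 1 / (N : ℝ) ^ k (r + 1) * ∑ M ∈ Finset.range (N + 1), Vc k r M

lemma Vc_nonneg (k : ℕ → ℕ) (r N : ℕ) : 0 ≤ Vc k r N := by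
  induction r generalizing N with
  | zero =>
    unfold Vc
    positivity
  | succ r ih =>
    unfold Vc
    have := Finset.sum_nonneg (s := Finset.range (N + 1)) fun M _ => ih M
    positivity

lemma inv_zero_pow (k : ℕ → ℕ) (hk : ∀ i, 1 ≤ k i) (r : ℕ) : (1 : ℝ) / ((0 : ℕ) : ℝ) ^ k r = 0 := by
  have := hk r
  simp [zero_pow (show k r ≠ 0 by omega)]

lemma Vc_zero (k : ℕ → ℕ) (hk : ∀ i, 1 ≤ k i) (r : ℕ) : Vc k r 0 = 0 := by
  cases r <;> rw [Vc, inv_zero_pow k hk]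
  simp

lemma PP_row (k : ℕ → ℕ) (hk : ∀ i, 1 ≤ k i) (r M : ℕ) : PP k r 0 M = Vc k r (M + 1) := by
  induction r generalizing M with
  | zero =>
    rw [PP, (iterB dlt_good (k 0)).2.1]
    simp [dlt, Vc]
  | succ r ih =>
    rw [PP, (iterB (PP_good k hk r).1.opA _).2.1, opA_row, Vc, Finset.sum_range_succ', Vc_zero k hk]
    obtain ⟨c, hc⟩ : ∃ c, k (r + 1) = c + 1 := ⟨k (r + 1) - 1, by have := hk (r + 1); omega⟩
    simp only [opYs, ih, hc]
    push_cast
    have e1 : (0 : ℝ) < (M : ℝ) + 1 := by positivity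
    simp only [add_zero]
    field_simp
    ring

lemma UE_lt (k : ℕ → ℕ) (j r : ℕ) (h : r < j) (N : ℕ) : UE k j r N = ENNReal.ofReal (Vc k r N) := by
  induction r generalizing N with
  | zero =>
    simp [UE, chC, wu, Vc, h.ne]
  | succ r ih =>
    have ih' := ih (by omega)
    unfold UE at ih' ⊢
    unfold chC Vc
    simp only [ih']
    rw [ENNReal.ofReal_mul (by positivity), ← tsum_if_lt _ (Vc_nonneg k r)]
    congr 1
    · simp [wu, h.ne]
    · refine tsum_congr fun M => ?_
      have : RU j r M N ↔ M < N + 1 := by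
        unfold RU
        constructor
        · intro h1
          have := h1.1 (by omega)
          omega
        · intro h1
          exact ⟨fun _ => by omega, fun _ => by omega⟩
      simp only [this]

lemma UE_self (k : ℕ → ℕ) (j N : ℕ) :
    UE k j j N = ENNReal.ofReal ((k j : ℝ) / (N : ℝ) * Vc k j N) := by
  cases j with
  | zero => simp [UE, chC, wu, Vc]
  | succ j =>
    have ih' := UE_lt k (j + 1) j (by omega)
    unfold UE at ih' ⊢
    unfold chC Vc
    simp only [ih']
    rw [← mul_assoc, ENNReal.ofReal_mul (by positivity), ← tsum_if_lt _ (Vc_nonneg k j)]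
    congr 1
    · simp [wu]
    · refine tsum_congr fun M => ?_
      have : RU (j + 1) j M N ↔ M < N + 1 := by
        unfold RU
        constructor
        · intro h1
          have := h1.1 (by omega)
          omega
        · intro h1
          exact ⟨fun _ => by omega, fun _ => by omega⟩
      simp only [this]

lemma UE_succ (k : ℕ → ℕ) (j r : ℕ) (h : j ≤ r) (N : ℕ) :
    UE k j (r + 1) N
      = ENNReal.ofReal (1 / (N : ℝ) ^ k (r + 1)) * ∑' M, if N < M then UE k j r M else 0 := by
  unfold UE
  rw [chC]
  congr 1
  · simp [wu, show r + 1 ≠ j by omega]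
  · refine tsum_congr fun M => ?_
    have : RU j r M N ↔ N < M := by
      unfold RU
      constructor
      · intro h1
        exact h1.2 h
      · intro h1
        exact ⟨fun _ => by omega, fun _ => h1⟩
    simp only [this]

lemma UE_fin (k : ℕ → ℕ) (hk : ∀ i, 1 ≤ k i) (j r : ℕ) (h : j ≤ r) (d : ℕ) :
    ∑' N, UE k j r N * ENNReal.ofReal (hs (N - 1) ^ d) ≠ ⊤ := by
  induction r, h using Nat.le_induction generalizing d with
  | base =>
    obtain ⟨e, he⟩ := (PP_good k hk j).2
    have hV : ∀ m, Vc k j (m + 1) ≤ bd e m := fun m => by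
      rw [← PP_row k hk]
      exact (he m).2
    have hS : Summable fun N : ℕ => (k j : ℝ) / (N : ℝ) * Vc k j N * hs (N - 1) ^ d := by
      rw [← summable_nat_add_iff 1]
      refine Summable.of_nonneg_of_le (fun m => ?_) (fun m => ?_)
        ((bd_summable (e + d)).mul_left (k j : ℝ))
      · have h1 := Vc_nonneg k j (m + 1)
        have h2 := one_le_hs (m + 1 - 1)
        positivity
      · have h1 := hV m
        have h0 := Vc_nonneg k j (m + 1)
        have h2 := one_le_hs m
        simp only [Nat.add_sub_cancel]
        push_cast
        calc (k j : ℝ) / ((m : ℝ) + 1) * Vc k j (m + 1) * hs m ^ d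
            ≤ (k j : ℝ) / ((m : ℝ) + 1) * bd e m * hs m ^ d := by gcongr
          _ = (k j : ℝ) * (bd (e + d) m / ((m : ℝ) + 1)) := by
              unfold bd
              rw [pow_add]
              ring
    have h3 : ∀ N, UE k j j N * ENNReal.ofReal (hs (N - 1) ^ d)
        = ENNReal.ofReal ((k j : ℝ) / (N : ℝ) * Vc k j N * hs (N - 1) ^ d) := by
      intro N
      have h1 := Vc_nonneg k j N
      rw [UE_self, ← ENNReal.ofReal_mul (by positivity)]
    simp only [h3]
    exact hS.tsum_ofReal_ne_top
  | succ r hr ih =>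
    have key : ∀ M : ℕ, (∑' N : ℕ, if N < M then
        ENNReal.ofReal (1 / (N : ℝ) ^ k (r + 1) * hs (N - 1) ^ d) else 0)
        ≤ ENNReal.ofReal (hs (M - 1) ^ (d + 1)) := by
      intro M
      have hn : ∀ N : ℕ, (0 : ℝ) ≤ 1 / (N : ℝ) ^ k (r + 1) * hs (N - 1) ^ d := fun N => by
        have := one_le_hs (N - 1)
        positivity
      rw [tsum_if_lt (fun N : ℕ => 1 / (N : ℝ) ^ k (r + 1) * hs (N - 1) ^ d) hn]
      refine ENNReal.ofReal_le_ofReal ?_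
      cases M with
      | zero =>
        have := one_le_hs (0 - 1)
        simp only [Finset.range_zero, Finset.sum_empty]
        positivity
      | succ m =>
        rw [Finset.sum_range_succ', inv_zero_pow k hk]
        simp only [Nat.add_sub_cancel, zero_mul, add_zero]
        refine le_trans ?_ (sum_bd_le d m)
        rw [Finset.sum_range_succ]
        refine le_trans ?_ (le_add_of_nonneg_right (bd_nonneg d m))
        refine Finset.sum_le_sum fun i _ => ?_
        have h1 := one_le_hs i
        have h2 : (i : ℝ) + 1 ≤ ((i : ℝ) + 1) ^ k (r + 1) :=
          le_self_pow₀ (by linarith [(Nat.cast_nonneg i : (0 : ℝ) ≤ i)])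
            (by have := hk (r + 1); omega)
        unfold bd
        push_cast
        rw [div_mul_eq_mul_div, one_mul]
        gcongr
    refine ne_top_of_le_ne_top (ih (d + 1)) ?_
    calc ∑' N, UE k j (r + 1) N * ENNReal.ofReal (hs (N - 1) ^ d)
        = ∑' N : ℕ, ∑' M : ℕ, UE k j r M * (if N < M then
            ENNReal.ofReal (1 / (N : ℝ) ^ k (r + 1) * hs (N - 1) ^ d) else 0) := by
          refine tsum_congr fun N => ?_
          rw [UE_succ k j r hr, mul_right_comm, ← ENNReal.ofReal_mul (by positivity),
            ← ENNReal.tsum_mul_left]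
          refine tsum_congr fun M => ?_
          split_ifs
          · rw [mul_comm]
          · simp
      _ = ∑' M : ℕ, UE k j r M * ∑' N : ℕ, (if N < M then
            ENNReal.ofReal (1 / (N : ℝ) ^ k (r + 1) * hs (N - 1) ^ d) else 0) := by
          rw [ENNReal.tsum_comm]
          exact tsum_congr fun M => ENNReal.tsum_mul_left
      _ ≤ _ := ENNReal.tsum_le_tsum fun M => by
          gcongr
          exact key M

lemma UE_sum (k : ℕ → ℕ) (hk : ∀ i, 1 ≤ k i) (j r : ℕ) (h : j ≤ r) : ∑' N, UE k j r N ≠ ⊤ := by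
  simpa using UE_fin k hk j r h 0

def UU (k : ℕ → ℕ) (j r N : ℕ) : ℝ := (UE k j r N).toReal

lemma UU_summable (k : ℕ → ℕ) (hk : ∀ i, 1 ≤ k i) (j r : ℕ) (h : j ≤ r) :
    Summable (UU k j r) := ENNReal.summable_toReal (UE_sum k hk j r h)

lemma UU_summable_add (k : ℕ → ℕ) (hk : ∀ i, 1 ≤ k i) (j r : ℕ) (h : j ≤ r) (N : ℕ) :
    Summable (fun m => UU k j r (N + m + 1)) := by
  have := (summable_nat_add_iff (N + 1)).mpr (UU_summable k hk j r h)
  refine this.congr fun m => ?_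
  congr 1
  ring

lemma UU_self (k : ℕ → ℕ) (j N : ℕ) : UU k j j N = (k j : ℝ) / (N : ℝ) * Vc k j N := by
  have := Vc_nonneg k j N
  rw [UU, UE_self, ENNReal.toReal_ofReal (by positivity)]

lemma UU_succ (k : ℕ → ℕ) (hk : ∀ i, 1 ≤ k i) (j r : ℕ) (h : j ≤ r) (N : ℕ) :
    UU k j (r + 1) N = 1 / (N : ℝ) ^ k (r + 1) * ∑' m, UU k j r (N + m + 1) := by
  rw [UU, UE_succ k j r h, ENNReal.toReal_mul, ENNReal.toReal_ofReal (by positivity),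
    ENNReal.tsum_toReal_eq]
  · congr 1
    have hinj : Function.Injective (fun m : ℕ => N + m + 1) := fun a b h => by
      simp only at h
      omega
    rw [← hinj.tsum_eq (f := fun M => (if N < M then UE k j r M else 0).toReal)]
    · refine tsum_congr fun m => ?_
      rw [if_pos (by omega)]
      rfl
    · intro M hM
      have : N < M := by
        by_contra hc
        simp [hc] at hM
      exact ⟨M - N - 1, by simp only; omega⟩
  · intro M
    split_ifs
    · exact ENNReal.ne_top_of_tsum_ne_top (UE_sum k hk j r h) M
    · simp

lemma EE_of_TT (k : ℕ → ℕ) (hk : ∀ i, 1 ≤ k i) (r : ℕ)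
    (hT : ∀ M, TT (PP k r) M = ∑ j ∈ Finset.range (r + 1), (-1 : ℝ) ^ (r - j) * UU k j r (M + 1))
    (N : ℕ) : EE (PP k r) N
      = ∑ j ∈ Finset.range (r + 1), (-1 : ℝ) ^ (r - j) * ∑' m, UU k j r (N + m + 1) := by
  obtain ⟨h1, h2⟩ := PP_good k hk r
  refine (h1.hasSum_TT h2 N).unique ?_
  simp only [hT]
  refine hasSum_sum fun j hj => ?_
  exact (UU_summable_add k hk j r (by simp at hj; omega) N).hasSum.mul_left _

lemma TT_PP (k : ℕ → ℕ) (hk : ∀ i, 1 ≤ k i) (r M : ℕ) :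
    TT (PP k r) M = ∑ j ∈ Finset.range (r + 1), (-1 : ℝ) ^ (r - j) * UU k j r (M + 1) := by
  induction r generalizing M with
  | zero =>
    rw [PP, (iterB dlt_good (k 0)).2.2.1]
    have e1 : (0 : ℝ) < (M : ℝ) + 1 := by positivity
    simp [TT, dlt, UU_self, Vc]
    field_simp
    ring
  | succ r ih =>
    have hE := EE_of_TT k hk r ih (M + 1)
    have hG := (PP_good k hk r).1
    have h1 := hG.TT_opA M
    have hrow := PP_row k hk (r + 1) M
    rw [PP, (iterB hG.opA _).2.1] at hrow
    rw [PP, (iterB hG.opA _).2.2.1, Finset.sum_range_succ, UU_self, ← hrow]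
    have h2 : ∑ j ∈ Finset.range (r + 1), (-1 : ℝ) ^ (r + 1 - j) * UU k j (r + 1) (M + 1)
        = - (1 / ((M : ℝ) + 1) ^ k (r + 1)) * EE (PP k r) (M + 1) := by
      rw [hE, Finset.mul_sum]
      refine Finset.sum_congr rfl fun j hj => ?_
      have hj' : j ≤ r := by simp at hj; omega
      rw [UU_succ k hk j r hj', show r + 1 - j = (r - j) + 1 by omega, pow_succ]
      push_cast
      ring
    rw [h2]
    obtain ⟨c, hc⟩ : ∃ c, k (r + 1) = c + 1 := ⟨k (r + 1) - 1, by have := hk (r + 1); omega⟩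
    have e1 : (0 : ℝ) < (M : ℝ) + 1 := by positivity
    have h3 : TT (opA (PP k r)) M = (opA (PP k r) 0 M - EE (PP k r) (M + 1)) / ((M : ℝ) + 1) := by
      rw [← h1]
      field_simp
    rw [h3, hc]
    simp only [Nat.add_sub_cancel, Nat.sub_self]
    push_cast
    field_simp
    ring

lemma summand_eq (k : ℕ → ℕ) (r : ℕ) (j : Fin (r + 1))
    (n : {n : Fin (r + 1) → ℕ // UpDown (r + 1) j n}) :
    kawashimaSummand (r + 1) (fun i => k i.val) j n
      = (chF (RU j.val) (wu k j.val) r n.1).toReal := by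
  unfold chF
  rw [if_pos (show ∀ (i : ℕ) (h : i + 1 < r + 1), RU j.val i _ _ from fun i h => n.2.2 i h), ENNReal.toReal_prod]
  have h1 : ∀ i : Fin (r + 1), (wu k j.val i.val (n.1 i)).toReal
      = (if i = j then (k i.val : ℝ) / (n.1 i : ℝ) else 1) * (1 / (n.1 i : ℝ) ^ k i.val) := by
    intro i
    unfold wu
    simp only [Fin.ext_iff]
    rw [ENNReal.toReal_ofReal]
    split_ifs <;> positivity
  simp only [h1, Finset.prod_mul_distrib, Finset.prod_ite_eq', Finset.mem_univ, if_true]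
  rfl

lemma chF_ne_top (k : ℕ → ℕ) (j r : ℕ) (n : Fin (r + 1) → ℕ) : chF (RU j) (wu k j) r n ≠ ⊤ := by
  unfold chF
  split_ifs
  · exact ENNReal.prod_ne_top fun i _ => ENNReal.ofReal_ne_top
  · simp

lemma summand_summable (k : ℕ → ℕ) (hk : ∀ i, 1 ≤ k i) (r : ℕ) (j : Fin (r + 1)) :
    Summable (kawashimaSummand (r + 1) (fun i => k i.val) j) := by
  have h1 : Summable fun n : Fin (r + 1) → ℕ => (chF (RU j.val) (wu k j.val) r n).toReal := by
    refine ENNReal.summable_toReal ?_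
    rw [chF_tsum]
    exact UE_sum k hk j.val r (by omega)
  refine (h1.subtype {n | UpDown (r + 1) j n}).congr fun n => ?_
  exact (summand_eq k r j n).symm

lemma summand_tsum (k : ℕ → ℕ) (hk : ∀ i, 1 ≤ k i) (r : ℕ) (j : Fin (r + 1)) :
    ∑' n, kawashimaSummand (r + 1) (fun i => k i.val) j n = ∑' m, UU k j.val r (0 + m + 1) := by
  have h1 : ∑' n : Fin (r + 1) → ℕ, (chF (RU j.val) (wu k j.val) r n).toReal
      = ∑' N, UU k j.val r N := by
    rw [← ENNReal.tsum_toReal_eq (chF_ne_top k j.val r), chF_tsum, ENNReal.tsum_toReal_eq]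
    · rfl
    · intro N
      exact ENNReal.ne_top_of_tsum_ne_top (UE_sum k hk j.val r (by omega)) N
  have h0 : ∀ j, j ≤ r → UU k j r 0 = 0 := by
    intro j hj
    rcases hj.eq_or_lt with h | h
    · rw [← h, UU_self, Vc_zero k hk, mul_zero]
    · obtain ⟨q, rfl⟩ : ∃ q, r = q + 1 := ⟨r - 1, by omega⟩
      rw [UU_succ k hk _ _ (by omega), inv_zero_pow k hk, zero_mul]
  rw [tsum_shift _ (h0 j.val (by omega))] at h1
  simp only [zero_add]
  rw [← h1]
  refine (tsum_congr fun n => summand_eq k r j n).trans ?_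
  refine tsum_subtype_eq_of_support_subset (s := {n | UpDown (r + 1) j n})
    (f := fun n => (chF (RU j.val) (wu k j.val) r n).toReal) ?_
  intro n hn
  simp only [Function.mem_support, chF] at hn
  split_ifs at hn with h
  · refine ⟨fun i => ?_, fun i hi => h i hi⟩
    by_contra hc
    refine hn ?_
    rw [Finset.prod_eq_zero (Finset.mem_univ i)]
    · rfl
    · have := hk i.val
      rw [show n i = 0 by omega, wu, inv_zero_pow k hk]
      simp
  · simp at hn

/-- For positive integers `k₁,…,k_r`,
`Z(S(y^{k₁} x y^{k₂−1} x ⋯ x y^{k_r−1} x))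
  = ∑_{j=1}^r (−1)^{r−j} ∑_{0<n₁≤⋯≤n_j>n_{j+1}>⋯>n_r>0} (k_j/n_j)·1/(n₁^{k₁}⋯n_r^{k_r})`,
and all the series on the right-hand side converge.
Here `S(yw) = y S₁(w)`, and `y^{k₁} x y^{k₂−1} x ⋯ x y^{k_r−1} x
  = y · (y^{k₁−1}x)(y^{k₂−1}x)⋯(y^{k_r−1}x)`. -/
theorem statement12 (Z : H →ₗ[ℚ] ℝ) (hZ : IsZetaMap Z)
    (r : ℕ) (hr : 0 < r) (k : Fin r → ℕ) (hk : ∀ i, 1 ≤ k i) :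
    (∀ j : Fin r, Summable (kawashimaSummand r k j)) ∧
    Z (Hy * S1 ((List.ofFn fun i => Hy ^ (k i - 1) * Hx).prod))
      = ∑ j : Fin r,
          (-1 : ℝ) ^ (r - 1 - j.val) * ∑' n, kawashimaSummand r k j n := by
  obtain ⟨r, rfl⟩ : ∃ q, r = q + 1 := ⟨r - 1, by omega⟩
  obtain ⟨k, hk', rfl⟩ : ∃ k' : ℕ → ℕ, (∀ i, 1 ≤ k' i) ∧ k = fun i => k' i.val := by
    refine ⟨fun i => if h : i < r + 1 then k ⟨i, h⟩ else 1, fun i => ?_, ?_⟩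
    · simp only
      split_ifs
      · exact hk _
      · exact le_rfl
    · funext i
      simp only
      rw [dif_pos i.isLt]
  refine ⟨summand_summable k hk' r, ?_⟩
  rw [LHS_eq hZ k hk' r, EE_of_TT k hk' r (TT_PP k hk' r) 0, Finset.sum_range]
  refine Finset.sum_congr rfl fun j _ => ?_
  rw [summand_tsum k hk' r j, Nat.add_sub_cancel]

end
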